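/- Let C be a category with an ideal of null morphisms N with respect to which kernels and cokernels exist. Then the arrow category C→ (objects are morphisms a : A₀ → A₁ of C; morphisms (a : A₀ → A₁) → (b : B₀ → B₁) are pairs (f₀ : A₀ → B₀, f₁ : A₁ → B₁) with b ∘ f₀ = f₁ ∘ a) equipped with the ideal of those squares whose diagonal b ∘ f₀ = f₁ ∘ a lies in N, is a homological category. Furthermore, if (C, N) satisfies the modularity condition, then so does the arrow category with this ideal. -/

import Mathlib

open CategoryTheory

universe v u

/-- An ideal of "null morphisms" in a category: closed under composition with
arbitrary morphisms on either side. -/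
structure NullIdeal (C : Type u) [Category.{v} C] : Type (max u v) where
  null : ∀ ⦃A B : C⦄, (A ⟶ B) → Prop
  comp_left : ∀ ⦃A B D : C⦄ (f : A ⟶ B) (g : B ⟶ D), null f → null (f ≫ g)
  comp_right : ∀ ⦃A B D : C⦄ (f : A ⟶ B) (g : B ⟶ D), null g → null (f ≫ g)

variable {C : Type u} [Category.{v} C]

/-- `k : S ⟶ A` is a kernel of `f : A ⟶ B` with respect to the ideal `N`. -/
def IsKer (N : NullIdeal C) {S A B : C} (k : S ⟶ A) (f : A ⟶ B) : Prop :=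
  N.null (k ≫ f) ∧ ∀ ⦃T : C⦄ (g : T ⟶ A), N.null (g ≫ f) → ∃! h : T ⟶ S, h ≫ k = g

/-- `q : B ⟶ Q` is a cokernel of `f : A ⟶ B` with respect to the ideal `N`. -/
def IsCoker (N : NullIdeal C) {A B Q : C} (f : A ⟶ B) (q : B ⟶ Q) : Prop :=
  N.null (f ≫ q) ∧ ∀ ⦃T : C⦄ (g : B ⟶ T), N.null (f ≫ g) → ∃! h : Q ⟶ T, q ≫ h = g

/-- A normal monomorphism is a morphism which is a kernel of some morphism. -/
def IsNormalMonoN (N : NullIdeal C) {S A : C} (s : S ⟶ A) : Prop :=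
  ∃ (B : C) (f : A ⟶ B), IsKer N s f

/-- A normal epimorphism is a morphism which is a cokernel of some morphism. -/
def IsNormalEpiN (N : NullIdeal C) {A Q : C} (q : A ⟶ Q) : Prop :=
  ∃ (B : C) (f : B ⟶ A), IsCoker N f q

/-- A choice of kernels and cokernels for all morphisms, w.r.t. the ideal `N`. -/
structure KernelChoice (N : NullIdeal C) where
  Ker : ∀ {A B : C}, (A ⟶ B) → C
  ker : ∀ {A B : C} (f : A ⟶ B), Ker f ⟶ A
  isKer : ∀ {A B : C} (f : A ⟶ B), IsKer N (ker f) f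
  Coker : ∀ {A B : C}, (A ⟶ B) → C
  coker : ∀ {A B : C} (f : A ⟶ B), B ⟶ Coker f
  isCoker : ∀ {A B : C} (f : A ⟶ B), IsCoker N f (coker f)

/-- Factorization (pre)order on (normal) subobjects of `A`. -/
def SubLe {S T A : C} (s : S ⟶ A) (t : T ⟶ A) : Prop := ∃ h : S ⟶ T, h ≫ t = s

/-- Two monomorphisms into `A` represent the same subobject of `A`. -/
def SubEquiv {S T A : C} (s : S ⟶ A) (t : T ⟶ A) : Prop := ∃ φ : S ≅ T, φ.hom ≫ t = s

/-- Two epimorphisms out of `A` represent the same quotient object of `A`. -/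
def QuotEquiv {A S T : C} (q : A ⟶ S) (r : A ⟶ T) : Prop := ∃ φ : S ≅ T, q ≫ φ.hom = r

/-- The pullback `f* t = ker (coker t ∘ f)` of a normal subobject `t` along `f`. -/
def pullN {N : NullIdeal C} (K : KernelChoice N) {A B T : C} (f : A ⟶ B) (t : T ⟶ B) :
    K.Ker (f ≫ K.coker t) ⟶ A := K.ker (f ≫ K.coker t)

/-- The pushforward `f_* s = im (f ∘ s) = ker (coker (f ∘ s))` of a normal subobject `s`
along `f`. -/
def pushN {N : NullIdeal C} (K : KernelChoice N) {A B S : C} (f : A ⟶ B) (s : S ⟶ A) :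
    K.Ker (K.coker (s ≫ f)) ⟶ B := K.ker (K.coker (s ≫ f))

/-- The image `im f = ker (coker f)`. -/
def imN {N : NullIdeal C} (K : KernelChoice N) {A B : C} (f : A ⟶ B) :
    K.Ker (K.coker f) ⟶ B := K.ker (K.coker f)

/-- The meet `s ∧ t = s_* s* t` of two normal subobjects of `A`. -/
def meetN {N : NullIdeal C} (K : KernelChoice N) {A S T : C} (s : S ⟶ A) (t : T ⟶ A) :=
  pushN K s (pullN K s t)

/-- The join `s ∨ t = (coker t)* (coker t)_* s` of two normal subobjects of `A`. -/
def joinN {N : NullIdeal C} (K : KernelChoice N) {A S T : C} (s : S ⟶ A) (t : T ⟶ A) :=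
  pullN K (K.coker t) (pushN K (K.coker t) s)

/-- `C` has kernels and cokernels of all morphisms with respect to `N`. -/
def HasKerCoker (N : NullIdeal C) : Prop :=
  (∀ {A B : C} (f : A ⟶ B), ∃ (S : C) (k : S ⟶ A), IsKer N k f) ∧
  (∀ {A B : C} (f : A ⟶ B), ∃ (Q : C) (q : B ⟶ Q), IsCoker N f q)

/-- `(C, N)` is a homological category: kernels and cokernels exist, the ideal is closed
(null morphisms factor through null objects), normal monomorphisms and normal epimorphisms
compose, and the homology axiom holds. -/
def IsHomologicalN (N : NullIdeal C) : Prop :=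
  HasKerCoker N ∧
  (∀ {A B : C} (f : A ⟶ B), N.null f →
    ∃ (Z : C) (g : A ⟶ Z) (h : Z ⟶ B), N.null (𝟙 Z) ∧ g ≫ h = f) ∧
  (∀ {A B D : C} (f : A ⟶ B) (g : B ⟶ D),
    IsNormalMonoN N f → IsNormalMonoN N g → IsNormalMonoN N (f ≫ g)) ∧
  (∀ {A B D : C} (f : A ⟶ B) (g : B ⟶ D),
    IsNormalEpiN N f → IsNormalEpiN N g → IsNormalEpiN N (f ≫ g)) ∧
  (∀ {A B D : C} (i : A ⟶ B) (q : B ⟶ D), IsNormalMonoN N i → IsNormalEpiN N q →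
    (∀ {S Q : C} (k : S ⟶ B) (c : B ⟶ Q), IsKer N k q → IsCoker N i c → N.null (k ≫ c)) →
    ∃ (H : C) (e : A ⟶ H) (m : H ⟶ D),
      IsNormalEpiN N e ∧ IsNormalMonoN N m ∧ e ≫ m = i ≫ q)

/-- The modularity condition for `(C, N)`, expressed via a choice `K` of kernels and
cokernels: all normal subobject lattices are modular, and every morphism is left modular
and right modular. -/
def ModularityFor {N : NullIdeal C} (K : KernelChoice N) : Prop :=
  (∀ {A S₁ S₂ T : C} (s₁ : S₁ ⟶ A) (s₂ : S₂ ⟶ A) (t : T ⟶ A),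
    IsNormalMonoN N s₁ → IsNormalMonoN N s₂ → IsNormalMonoN N t → SubLe s₁ s₂ →
    SubEquiv (joinN K s₁ (meetN K t s₂)) (meetN K (joinN K s₁ t) s₂)) ∧
  (∀ {A B S : C} (f : A ⟶ B) (s : S ⟶ A), IsNormalMonoN N s →
    SubEquiv (pullN K f (pushN K f s)) (joinN K s (K.ker f))) ∧
  (∀ {A B T : C} (f : A ⟶ B) (t : T ⟶ B), IsNormalMonoN N t →
    SubEquiv (pushN K f (pullN K f t)) (meetN K t (imN K f)))

/-- The ideal on the arrow category `C→` consisting of the squares whose diagonal is a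
null morphism of `C`. -/
def arrowIdeal (N : NullIdeal C) : NullIdeal (Arrow C) where
  null {a b} f := N.null (f.left ≫ b.hom)
  comp_left {a b c} f g hf := by
    show N.null ((f ≫ g).left ≫ c.hom)
    have h : (f ≫ g).left ≫ c.hom = (f.left ≫ b.hom) ≫ g.right := by
      rw [Arrow.comp_left, Category.assoc, Arrow.w g, Category.assoc]
    rw [h]
    exact N.comp_left _ _ hf
  comp_right {a b c} f g hg := by
    show N.null ((f ≫ g).left ≫ c.hom)
    have h : (f ≫ g).left ≫ c.hom = f.left ≫ (g.left ≫ c.hom) := by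
      rw [Arrow.comp_left, Category.assoc]
    rw [h]
    exact N.comp_right _ _ hg

section KernelsAndCokernels

variable {N : NullIdeal C}

lemma IsKer.subLe_iff {S A B X : C} {k : S ⟶ A} {f : A ⟶ B} (hk : IsKer N k f) (x : X ⟶ A) :
    SubLe x k ↔ N.null (x ≫ f) := by
  constructor
  · rintro ⟨h, rfl⟩
    rw [Category.assoc]
    exact N.comp_right _ _ hk.1
  · intro hx
    exact (hk.2 x hx).exists

lemma IsKer.mono {S A B : C} {k : S ⟶ A} {f : A ⟶ B} (hk : IsKer N k f) : Mono k where
  right_cancellation g h e := by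
    have hn : N.null ((h ≫ k) ≫ f) := (hk.subLe_iff _).1 ⟨h, rfl⟩
    exact (hk.2 _ hn).unique e rfl

lemma IsCoker.epi {A B Q : C} {f : A ⟶ B} {q : B ⟶ Q} (hq : IsCoker N f q) : Epi q where
  left_cancellation g h e := by
    have hn : N.null (f ≫ q ≫ h) := by
      rw [← Category.assoc]
      exact N.comp_left _ _ hq.1
    exact (hq.2 _ hn).unique e rfl

lemma IsCoker.exists_desc_iff {A B Q Z : C} {f : A ⟶ B} {q : B ⟶ Q} (hq : IsCoker N f q)
    (g : B ⟶ Z) : (∃ h, q ≫ h = g) ↔ N.null (f ≫ g) := by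
  constructor
  · rintro ⟨h, rfl⟩
    rw [← Category.assoc]
    exact N.comp_left _ _ hq.1
  · intro hg
    exact (hq.2 g hg).exists

lemma isKer_of_mono {S A B : C} {k : S ⟶ A} {f : A ⟶ B} [Mono k]
    (h : ∀ ⦃X : C⦄ (x : X ⟶ A), SubLe x k ↔ N.null (x ≫ f)) : IsKer N k f := by
  refine ⟨(h k).1 ⟨𝟙 _, Category.id_comp k⟩, fun X x hx => ?_⟩
  obtain ⟨y, hy⟩ := (h x).2 hx
  exact ⟨y, hy, fun z hz => (cancel_mono k).1 (hz.trans hy.symm)⟩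

lemma isCoker_of_epi {A B Q : C} {f : A ⟶ B} {q : B ⟶ Q} [Epi q]
    (h : ∀ ⦃Z : C⦄ (g : B ⟶ Z), (∃ u, q ≫ u = g) ↔ N.null (f ≫ g)) : IsCoker N f q := by
  refine ⟨(h q).1 ⟨𝟙 _, Category.comp_id q⟩, fun Z g hg => ?_⟩
  obtain ⟨y, hy⟩ := (h g).2 hg
  exact ⟨y, hy, fun z hz => (cancel_epi q).1 (hz.trans hy.symm)⟩

lemma IsKer.exists_iso {S T A B : C} {k : S ⟶ A} {l : T ⟶ A} {f : A ⟶ B}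
    (hk : IsKer N k f) (hl : IsKer N l f) : ∃ φ : S ≅ T, φ.hom ≫ l = k := by
  have := hk.mono
  have := hl.mono
  obtain ⟨u, hu⟩ := (hl.subLe_iff k).2 hk.1
  obtain ⟨w, hw⟩ := (hk.subLe_iff l).2 hl.1
  exact ⟨⟨u, w, by simp [← cancel_mono k, hu, hw], by simp [← cancel_mono l, hu, hw]⟩, hu⟩

lemma IsCoker.exists_iso {A B Q R : C} {f : A ⟶ B} {q : B ⟶ Q} {r : B ⟶ R}
    (hq : IsCoker N f q) (hr : IsCoker N f r) : ∃ φ : R ≅ Q, r ≫ φ.hom = q := by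
  have := hq.epi
  have := hr.epi
  obtain ⟨u, hu⟩ := (hr.exists_desc_iff q).2 hq.1
  obtain ⟨w, hw⟩ := (hq.exists_desc_iff r).2 hr.1
  exact ⟨⟨u, w, by simp [← cancel_epi r, reassoc_of% hu, hw],
    by simp [← cancel_epi q, reassoc_of% hw, hu]⟩, hu⟩

lemma IsKer.iso_comp {S T A B : C} {k : S ⟶ A} {f : A ⟶ B} (hk : IsKer N k f) (φ : T ≅ S) :
    IsKer N (φ.hom ≫ k) f := by
  have := hk.mono
  have : Mono (φ.hom ≫ k) := mono_comp _ _
  refine isKer_of_mono fun X x => ?_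
  rw [← hk.subLe_iff]
  exact ⟨fun ⟨h, e⟩ => ⟨h ≫ φ.hom, by simpa using e⟩, fun ⟨h, e⟩ => ⟨h ≫ φ.inv, by simpa using e⟩⟩

lemma IsCoker.comp_iso {A B Q R : C} {f : A ⟶ B} {q : B ⟶ Q} (hq : IsCoker N f q) (φ : Q ≅ R) :
    IsCoker N f (q ≫ φ.hom) := by
  have := hq.epi
  have : Epi (q ≫ φ.hom) := epi_comp _ _
  refine isCoker_of_epi fun X x => ?_
  rw [← hq.exists_desc_iff]
  exact ⟨fun ⟨h, e⟩ => ⟨φ.hom ≫ h, by simpa using e⟩, fun ⟨h, e⟩ => ⟨φ.inv ≫ h, by simpa using e⟩⟩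

lemma IsNormalMonoN.mono {S A : C} {s : S ⟶ A} (hs : IsNormalMonoN N s) : Mono s :=
  let ⟨_, _, h⟩ := hs
  h.mono

lemma null_comp_of_subLe {A S T Z : C} {s : S ⟶ A} {t : T ⟶ A} {g : A ⟶ Z}
    (h : SubLe s t) (ht : N.null (t ≫ g)) : N.null (s ≫ g) := by
  obtain ⟨u, rfl⟩ := h
  rw [Category.assoc]
  exact N.comp_right _ _ ht

lemma IsNormalMonoN.subLe_iff {S A X : C} {s : S ⟶ A} (hs : IsNormalMonoN N s) (x : X ⟶ A) :
    SubLe x s ↔ ∀ ⦃Z : C⦄ (g : A ⟶ Z), N.null (s ≫ g) → N.null (x ≫ g) := by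
  constructor
  · exact fun h Z g hg => null_comp_of_subLe h hg
  · obtain ⟨B, f, hf⟩ := hs
    exact fun h => (hf.subLe_iff x).2 (h f hf.1)

lemma subEquiv_iff {S T A : C} {s : S ⟶ A} {t : T ⟶ A} (hs : Mono s) (ht : Mono t) :
    SubEquiv s t ↔ ∀ ⦃X : C⦄ (x : X ⟶ A), SubLe x s ↔ SubLe x t := by
  constructor
  · rintro ⟨φ, rfl⟩ X x
    exact ⟨fun ⟨h, e⟩ => ⟨h ≫ φ.hom, by simpa using e⟩,
      fun ⟨h, e⟩ => ⟨h ≫ φ.inv, by simpa using e⟩⟩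
  · intro h
    obtain ⟨u, hu⟩ := (h s).1 ⟨𝟙 _, Category.id_comp _⟩
    obtain ⟨w, hw⟩ := (h t).2 ⟨𝟙 _, Category.id_comp _⟩
    exact ⟨⟨u, w, by simp [← cancel_mono s, hu, hw], by simp [← cancel_mono t, hu, hw]⟩, hu⟩

variable (K : KernelChoice N)

lemma KernelChoice.null_comp_coker_iff {A B X : C} (f : A ⟶ B) (x : X ⟶ B) :
    N.null (x ≫ K.coker f) ↔ ∀ ⦃Z : C⦄ (g : B ⟶ Z), N.null (f ≫ g) → N.null (x ≫ g) := by
  constructor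
  · intro hx Z g hg
    obtain ⟨u, rfl⟩ := ((K.isCoker f).exists_desc_iff g).2 hg
    rw [← Category.assoc]
    exact N.comp_left _ _ hx
  · exact fun h => h _ (K.isCoker f).1

lemma subLe_pushN_iff {A B S X : C} (f : A ⟶ B) (s : S ⟶ A) (x : X ⟶ B) :
    SubLe x (pushN K f s) ↔
      ∀ ⦃Z : C⦄ (g : B ⟶ Z), N.null (s ≫ f ≫ g) → N.null (x ≫ g) := by
  rw [pushN, (K.isKer _).subLe_iff, K.null_comp_coker_iff]
  simp only [Category.assoc]

lemma subLe_imN_iff {A B X : C} (f : A ⟶ B) (x : X ⟶ B) :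
    SubLe x (imN K f) ↔ ∀ ⦃Z : C⦄ (g : B ⟶ Z), N.null (f ≫ g) → N.null (x ≫ g) := by
  rw [imN, (K.isKer _).subLe_iff, K.null_comp_coker_iff]

lemma subLe_pullN_iff {A B T X : C} (f : A ⟶ B) (t : T ⟶ B) (x : X ⟶ A) :
    SubLe x (pullN K f t) ↔
      ∀ ⦃Z : C⦄ (g : B ⟶ Z), N.null (t ≫ g) → N.null (x ≫ f ≫ g) := by
  rw [pullN, (K.isKer _).subLe_iff, ← Category.assoc, K.null_comp_coker_iff]
  simp only [Category.assoc]

lemma isNormalMonoN_pushN {A B S : C} (f : A ⟶ B) (s : S ⟶ A) : IsNormalMonoN N (pushN K f s) :=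
  ⟨_, _, K.isKer _⟩

lemma isNormalMonoN_pullN {A B T : C} (f : A ⟶ B) (t : T ⟶ B) : IsNormalMonoN N (pullN K f t) :=
  ⟨_, _, K.isKer _⟩

lemma isNormalMonoN_joinN {A S T : C} (s : S ⟶ A) (t : T ⟶ A) : IsNormalMonoN N (joinN K s t) :=
  ⟨_, _, K.isKer _⟩

lemma isNormalMonoN_meetN {A S T : C} (s : S ⟶ A) (t : T ⟶ A) : IsNormalMonoN N (meetN K s t) :=
  ⟨_, _, K.isKer _⟩

lemma isNormalMonoN_imN {A B : C} (f : A ⟶ B) : IsNormalMonoN N (imN K f) :=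
  ⟨_, _, K.isKer _⟩

lemma subLe_pullN_iff_of_normal {A B T X : C} (f : A ⟶ B) {t : T ⟶ B} (ht : IsNormalMonoN N t)
    (x : X ⟶ A) : SubLe x (pullN K f t) ↔ SubLe (x ≫ f) t := by
  rw [subLe_pullN_iff, ht.subLe_iff]
  simp only [Category.assoc]

lemma null_pushN_comp_iff {A B S Z : C} (f : A ⟶ B) (s : S ⟶ A) (g : B ⟶ Z) :
    N.null (pushN K f s ≫ g) ↔ N.null (s ≫ f ≫ g) := by
  constructor
  · intro h
    obtain ⟨u, hu⟩ := (subLe_pushN_iff K f s (s ≫ f)).2 fun Z g hg => by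
      rwa [Category.assoc]
    rw [← Category.assoc, ← hu, Category.assoc]
    exact N.comp_right _ _ h
  · exact (subLe_pushN_iff K f s _).1 ⟨𝟙 _, Category.id_comp _⟩ g

lemma subLe_joinN_iff {A S T X : C} (s : S ⟶ A) (t : T ⟶ A) (x : X ⟶ A) :
    SubLe x (joinN K s t) ↔
      ∀ ⦃Z : C⦄ (g : A ⟶ Z), N.null (s ≫ g) → N.null (t ≫ g) → N.null (x ≫ g) := by
  rw [joinN, subLe_pullN_iff]
  simp only [null_pushN_comp_iff]
  constructor
  · intro h Z g hs ht
    obtain ⟨u, rfl⟩ := ((K.isCoker t).exists_desc_iff g).2 ht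
    exact h u hs
  · intro h Z g hs
    exact h _ hs (((K.isCoker t).exists_desc_iff _).1 ⟨g, rfl⟩)

lemma null_joinN_comp {A S T Z : C} {s : S ⟶ A} {t : T ⟶ A} {g : A ⟶ Z}
    (hs : N.null (s ≫ g)) (ht : N.null (t ≫ g)) : N.null (joinN K s t ≫ g) :=
  (subLe_joinN_iff K s t _).1 ⟨𝟙 _, Category.id_comp _⟩ g hs ht

lemma subLe_meetN_iff {A S T X : C} {s : S ⟶ A} {t : T ⟶ A} (hs : IsNormalMonoN N s)
    (ht : IsNormalMonoN N t) (x : X ⟶ A) :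
    SubLe x (meetN K s t) ↔ SubLe x s ∧ SubLe x t := by
  rw [meetN, subLe_pushN_iff]
  constructor
  · intro h
    rw [hs.subLe_iff, ht.subLe_iff]
    refine ⟨fun Z g hg => h g (N.comp_right _ _ hg), fun Z g hg => h g ?_⟩
    exact (subLe_pullN_iff K s t _).1 ⟨𝟙 _, Category.id_comp _⟩ g hg
  · rintro ⟨⟨y, rfl⟩, hy⟩ Z g hg
    obtain ⟨z, rfl⟩ := (subLe_pullN_iff_of_normal K s ht y).2 hy
    simp only [Category.assoc]
    exact N.comp_right _ _ hg

lemma left_subLe_joinN {A S T : C} (s : S ⟶ A) (t : T ⟶ A) : SubLe s (joinN K s t) :=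
  (subLe_joinN_iff K s t s).2 fun _ _ h _ => h

lemma right_subLe_joinN {A S T : C} (s : S ⟶ A) (t : T ⟶ A) : SubLe t (joinN K s t) :=
  (subLe_joinN_iff K s t t).2 fun _ _ _ h => h

lemma modularityFor_iff : ModularityFor K ↔
    (∀ {A S₁ S₂ T : C} (s₁ : S₁ ⟶ A) (s₂ : S₂ ⟶ A) (t : T ⟶ A),
      IsNormalMonoN N s₁ → IsNormalMonoN N s₂ → IsNormalMonoN N t → SubLe s₁ s₂ →
      ∀ ⦃X : C⦄ (x : X ⟶ A), SubLe x (joinN K s₁ t) → SubLe x s₂ →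
        SubLe x (joinN K s₁ (meetN K t s₂))) ∧
    (∀ {A B S : C} (f : A ⟶ B) (s : S ⟶ A), IsNormalMonoN N s → ∀ ⦃X : C⦄ (x : X ⟶ A),
      (∀ ⦃Z : C⦄ (g : B ⟶ Z), N.null (s ≫ f ≫ g) → N.null (x ≫ f ≫ g)) →
        SubLe x (joinN K s (K.ker f))) ∧
    (∀ {A B T : C} (f : A ⟶ B) (t : T ⟶ B), IsNormalMonoN N t → ∀ ⦃X : C⦄ (x : X ⟶ B),
      SubLe x t → SubLe x (imN K f) → SubLe x (pushN K f (pullN K f t))) := by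
  refine and_congr ⟨?_, ?_⟩ (and_congr ⟨?_, ?_⟩ ⟨?_, ?_⟩)
  · intro H A S₁ S₂ T s₁ s₂ t h₁ h₂ ht hle X x hx hx'
    refine (((subEquiv_iff ?_ ?_).1 (H s₁ s₂ t h₁ h₂ ht hle)) x).2 ?_
    · exact (isNormalMonoN_joinN K _ _).mono
    · exact (isNormalMonoN_meetN K _ _).mono
    · exact (subLe_meetN_iff K (isNormalMonoN_joinN K _ _) h₂ x).2 ⟨hx, hx'⟩
  · intro H A S₁ S₂ T s₁ s₂ t h₁ h₂ ht hle
    refine (subEquiv_iff (isNormalMonoN_joinN K _ _).mono (isNormalMonoN_meetN K _ _).mono).2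
      fun X x => ?_
    rw [subLe_meetN_iff K (isNormalMonoN_joinN K _ _) h₂]
    refine ⟨fun hx => ?_, fun hx => H s₁ s₂ t h₁ h₂ ht hle x hx.1 hx.2⟩
    have hm := (subLe_meetN_iff K ht h₂ (meetN K t s₂)).1 ⟨𝟙 _, Category.id_comp _⟩
    rw [ht.subLe_iff, h₂.subLe_iff] at hm
    rw [h₂.subLe_iff] at hle
    rw [subLe_joinN_iff] at hx
    rw [subLe_joinN_iff, h₂.subLe_iff]
    exact ⟨fun Z g h h' => hx g h (hm.1 g h'), fun Z g h => hx g (hle g h) (hm.2 g h)⟩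
  · intro H A B S f s hs X x hx
    refine (((subEquiv_iff ?_ ?_).1 (H f s hs)) x).1 ?_
    · exact (isNormalMonoN_pullN K _ _).mono
    · exact (isNormalMonoN_joinN K _ _).mono
    · rw [subLe_pullN_iff]
      simpa only [null_pushN_comp_iff] using hx
  · intro H A B S f s hs
    refine (subEquiv_iff (isNormalMonoN_pullN K _ _).mono (isNormalMonoN_joinN K _ _).mono).2
      fun X x => ?_
    rw [subLe_pullN_iff]
    simp only [null_pushN_comp_iff]
    refine ⟨fun hx => H f s hs x hx, fun hx Z g hg => ?_⟩
    refine (subLe_joinN_iff K _ _ _).1 hx _ hg ?_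
    rw [← Category.assoc]
    exact N.comp_left _ _ (K.isKer f).1
  · intro H A B T f t ht X x hx hx'
    refine (((subEquiv_iff ?_ ?_).1 (H f t ht)) x).2 ?_
    · exact (isNormalMonoN_pushN K _ _).mono
    · exact (isNormalMonoN_meetN K _ _).mono
    · exact (subLe_meetN_iff K ht (isNormalMonoN_imN K f) x).2 ⟨hx, hx'⟩
  · intro H A B T f t ht
    refine (subEquiv_iff (isNormalMonoN_pushN K _ _).mono (isNormalMonoN_meetN K _ _).mono).2
      fun X x => ?_
    rw [subLe_meetN_iff K ht (isNormalMonoN_imN K f)]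
    refine ⟨fun hx => ?_, fun hx => H f t ht x hx.1 hx.2⟩
    rw [subLe_pushN_iff] at hx
    rw [ht.subLe_iff, subLe_imN_iff]
    exact ⟨fun Z g hg => hx g ((subLe_pullN_iff K f t _).1 ⟨𝟙 _, Category.id_comp _⟩ g hg),
      fun Z g hg => hx g (N.comp_right _ _ hg)⟩

lemma exists_kernelChoice (hN : HasKerCoker N) : Nonempty (KernelChoice N) := by
  obtain ⟨hk, hc⟩ := hN
  choose S k hk using fun (A B : C) (f : A ⟶ B) => hk f
  choose Q q hq using fun (A B : C) (f : A ⟶ B) => hc f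
  exact ⟨⟨fun f => S _ _ f, fun f => k _ _ f, fun f => hk _ _ f,
    fun f => Q _ _ f, fun f => q _ _ f, fun f => hq _ _ f⟩⟩

end KernelsAndCokernels

section ArrowCategory

variable {N : NullIdeal C}

lemma arrowIdeal_null_iff {a b : Arrow C} (f : a ⟶ b) :
    (arrowIdeal N).null f ↔ N.null (f.left ≫ b.hom) := Iff.rfl

lemma arrowIdeal_null_iff_right {a b : Arrow C} (f : a ⟶ b) :
    (arrowIdeal N).null f ↔ N.null (a.hom ≫ f.right) := by
  rw [arrowIdeal_null_iff, Arrow.w]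

lemma arrowIdeal_null_comp_iff {a b c : Arrow C} (f : a ⟶ b) (g : b ⟶ c) :
    (arrowIdeal N).null (f ≫ g) ↔ N.null (f.left ≫ b.hom ≫ g.right) := by
  rw [arrowIdeal_null_iff, Arrow.comp_left, Category.assoc, Arrow.w]

lemma forall_arrow_hom_right_iff {a : Arrow C} (P : ∀ ⦃Z : C⦄, (a.right ⟶ Z) → Prop) :
    (∀ ⦃z : Arrow C⦄ (g : a ⟶ z), P g.right) ↔ ∀ ⦃Z : C⦄ (g : a.right ⟶ Z), P g :=
  ⟨fun h Z g => h (Arrow.homMk (𝟙 _) g (by simp) : a ⟶ Arrow.mk (a.hom ≫ g)),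
    fun h _ g => h g.right⟩

lemma arrow_isKer {s a b : Arrow C} {k : s ⟶ a} {f : a ⟶ b} [IsIso k.right]
    (hk : IsKer N k.left (f.left ≫ b.hom)) : IsKer (arrowIdeal N) k f := by
  have := hk.mono
  have : Mono k := ⟨fun g h e => by
    ext
    · rw [← cancel_mono k.left]
      exact congrArg (fun u => u.left) e
    · rw [← cancel_mono k.right]
      exact congrArg (fun u => u.right) e⟩
  refine isKer_of_mono fun x u => ?_
  rw [arrowIdeal_null_iff, Arrow.comp_left, Category.assoc, ← hk.subLe_iff]
  constructor
  · rintro ⟨h, rfl⟩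
    exact ⟨h.left, rfl⟩
  · rintro ⟨h, e⟩
    refine ⟨Arrow.homMk h (u.right ≫ inv k.right) ?_, ?_⟩
    · rw [← cancel_mono k.right]
      simp only [Category.assoc, IsIso.inv_hom_id, Category.comp_id]
      rw [← Arrow.w k, ← Arrow.w u, reassoc_of% e]
    · ext <;> simp [e]

lemma arrow_isCoker {a b d : Arrow C} {f : a ⟶ b} {q : b ⟶ d} [IsIso q.left]
    (hq : IsCoker N (a.hom ≫ f.right) q.right) : IsCoker (arrowIdeal N) f q := by
  have := hq.epi
  have : Epi q := ⟨fun g h e => by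
    ext
    · rw [← cancel_epi q.left]
      exact congrArg (fun u => u.left) e
    · rw [← cancel_epi q.right]
      exact congrArg (fun u => u.right) e⟩
  refine isCoker_of_epi fun x u => ?_
  rw [arrowIdeal_null_iff_right, Arrow.comp_right, ← Category.assoc, ← hq.exists_desc_iff]
  constructor
  · rintro ⟨h, rfl⟩
    exact ⟨h.right, rfl⟩
  · rintro ⟨h, e⟩
    refine ⟨Arrow.homMk (inv q.left ≫ u.left) h ?_, ?_⟩
    · rw [← cancel_epi q.left]
      simp [e]
    · ext <;> simp [e]

lemma arrow_isKer_iff (hN : HasKerCoker N) {s a b : Arrow C} {k : s ⟶ a} {f : a ⟶ b} :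
    IsKer (arrowIdeal N) k f ↔ IsIso k.right ∧ IsKer N k.left (f.left ≫ b.hom) := by
  refine ⟨fun h => ?_, fun ⟨_, h⟩ => arrow_isKer h⟩
  obtain ⟨S, l, hl⟩ := hN.1 (f.left ≫ b.hom)
  let m : Arrow.mk (l ≫ a.hom) ⟶ a := Arrow.homMk l (𝟙 _)
  have : IsIso m.right := inferInstanceAs (IsIso (𝟙 a.right))
  have hm : IsKer (arrowIdeal N) m f := arrow_isKer hl
  obtain ⟨φ, rfl⟩ := h.exists_iso hm
  refine ⟨?_, hl.iso_comp ((Arrow.leftFunc).mapIso φ)⟩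
  rw [Arrow.comp_right]
  infer_instance

lemma arrow_isCoker_iff (hN : HasKerCoker N) {a b d : Arrow C} {f : a ⟶ b} {q : b ⟶ d} :
    IsCoker (arrowIdeal N) f q ↔ IsIso q.left ∧ IsCoker N (a.hom ≫ f.right) q.right := by
  refine ⟨fun h => ?_, fun ⟨_, h⟩ => arrow_isCoker h⟩
  obtain ⟨S, l, hl⟩ := hN.2 (a.hom ≫ f.right)
  let m : b ⟶ Arrow.mk (b.hom ≫ l) := Arrow.homMk (𝟙 _) l
  have : IsIso m.left := inferInstanceAs (IsIso (𝟙 b.left))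
  have hm : IsCoker (arrowIdeal N) f m := arrow_isCoker hl
  obtain ⟨φ, rfl⟩ := h.exists_iso hm
  refine ⟨?_, hl.comp_iso ((Arrow.rightFunc).mapIso φ)⟩
  rw [Arrow.comp_left]
  infer_instance

lemma arrow_isNormalMonoN_iff (hN : HasKerCoker N) {s a : Arrow C} (k : s ⟶ a) :
    IsNormalMonoN (arrowIdeal N) k ↔
      IsIso k.right ∧ ∃ (Z : C) (g : a.right ⟶ Z), IsKer N k.left (a.hom ≫ g) := by
  constructor
  · rintro ⟨b, f, h⟩
    rw [arrow_isKer_iff hN, Arrow.w] at h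
    exact ⟨h.1, _, _, h.2⟩
  · rintro ⟨_, Z, g, h⟩
    refine ⟨_, (Arrow.homMk (𝟙 _) g (by simp) : a ⟶ Arrow.mk (a.hom ≫ g)), arrow_isKer ?_⟩
    simpa using h

lemma arrow_isNormalEpiN_iff (hN : HasKerCoker N) {b d : Arrow C} (q : b ⟶ d) :
    IsNormalEpiN (arrowIdeal N) q ↔
      IsIso q.left ∧ ∃ (X : C) (x : X ⟶ b.left), IsCoker N (x ≫ b.hom) q.right := by
  constructor
  · rintro ⟨b, f, h⟩
    rw [arrow_isCoker_iff hN, ← Arrow.w] at h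
    exact ⟨h.1, _, _, h.2⟩
  · rintro ⟨_, Z, g, h⟩
    refine ⟨_, (Arrow.homMk g (𝟙 _) (by simp) : Arrow.mk (g ≫ b.hom) ⟶ b), arrow_isCoker ?_⟩
    simpa using h

lemma arrow_hasKerCoker (hN : HasKerCoker N) : HasKerCoker (arrowIdeal N) := by
  constructor
  · intro a b f
    obtain ⟨S, l, hl⟩ := hN.1 (f.left ≫ b.hom)
    let m : Arrow.mk (l ≫ a.hom) ⟶ a := Arrow.homMk l (𝟙 _)
    have : IsIso m.right := inferInstanceAs (IsIso (𝟙 a.right))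
    exact ⟨_, m, arrow_isKer hl⟩
  · intro a b f
    obtain ⟨S, l, hl⟩ := hN.2 (a.hom ≫ f.right)
    let m : b ⟶ Arrow.mk (b.hom ≫ l) := Arrow.homMk (𝟙 _) l
    have : IsIso m.left := inferInstanceAs (IsIso (𝟙 b.left))
    exact ⟨_, m, arrow_isCoker hl⟩

lemma arrow_isHomologicalN (hN : HasKerCoker N) : IsHomologicalN (arrowIdeal N) := by
  refine ⟨arrow_hasKerCoker hN, ?_, ?_, ?_, ?_⟩
  · intro a b f hf
    refine ⟨Arrow.mk (f.left ≫ b.hom), Arrow.homMk (𝟙 _) f.right (by simp),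
      Arrow.homMk f.left (𝟙 _) (by simp), ?_, ?_⟩
    · rw [arrowIdeal_null_iff]
      simpa [arrowIdeal_null_iff] using hf
    · ext <;> simp
  · intro t s a k l hk hl
    rw [arrow_isNormalMonoN_iff hN] at hk hl ⊢
    obtain ⟨_, Z, g, hg⟩ := hk
    obtain ⟨_, W, h, hh⟩ := hl
    obtain ⟨Q, q, hq⟩ := hN.2 (k.left ≫ l.left ≫ a.hom)
    rw [Arrow.comp_right, Arrow.comp_left]
    refine ⟨inferInstance, Q, q, ?_⟩
    have := hg.mono
    have := hh.mono
    have : Mono (k.left ≫ l.left) := mono_comp _ _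
    refine isKer_of_mono fun X x => ⟨?_, fun hx => ?_⟩
    · rintro ⟨u, rfl⟩
      have := N.comp_right u _ hq.1
      simpa using this
    · obtain ⟨h', hh'⟩ := (hq.exists_desc_iff h).2 (by
        have := N.comp_right k.left _ hh.1
        simpa using this)
      obtain ⟨y, rfl⟩ := (hh.subLe_iff x).2 (by
        rw [← hh']
        have := N.comp_left _ h' hx
        simpa using this)
      obtain ⟨g', hg'⟩ := (hq.exists_desc_iff (inv l.right ≫ g)).2 (by
        have := hg.1
        simpa using this)
      obtain ⟨z, rfl⟩ := (hg.subLe_iff y).2 (by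
        have := N.comp_left _ g' hx
        simpa [hg'] using this)
      exact ⟨z, by simp⟩
  · intro b c d p r hp hr
    rw [arrow_isNormalEpiN_iff hN] at hp hr ⊢
    obtain ⟨_, Z, g, hg⟩ := hp
    obtain ⟨_, W, h, hh⟩ := hr
    obtain ⟨Q, q, hq⟩ := hN.1 (b.hom ≫ p.right ≫ r.right)
    rw [Arrow.comp_right, Arrow.comp_left]
    refine ⟨inferInstance, Q, q, ?_⟩
    have := hg.epi
    have := hh.epi
    have : Epi (p.right ≫ r.right) := epi_comp _ _
    refine isCoker_of_epi fun X x => ⟨?_, fun hx => ?_⟩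
    · rintro ⟨u, rfl⟩
      have := N.comp_left _ u hq.1
      simpa using this
    · obtain ⟨g', hg'⟩ := (hq.subLe_iff g).2 (by
        have := N.comp_left _ r.right hg.1
        simpa using this)
      obtain ⟨y, rfl⟩ := (hg.exists_desc_iff x).2 (by
        rw [← hg']
        have := N.comp_right g' _ hx
        simpa using this)
      have hb : inv p.left ≫ b.hom ≫ p.right = c.hom := by
        rw [IsIso.inv_comp_eq, Arrow.w]
      obtain ⟨h', hh'⟩ := (hq.subLe_iff (h ≫ inv p.left)).2 (by
        have := hh.1
        simpa [← hb] using this)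
      obtain ⟨z, rfl⟩ := (hh.exists_desc_iff y).2 (by
        have := N.comp_right h' _ hx
        simp only [Category.assoc] at this
        rw [reassoc_of% hh', reassoc_of% hb] at this
        simpa using this)
      exact ⟨z, by simp⟩
  · intro s a d i q hi hq hiq
    obtain ⟨k, kk, hk⟩ := (arrow_hasKerCoker hN).1 q
    obtain ⟨c, cc, hc⟩ := (arrow_hasKerCoker hN).2 i
    have hnull := hiq kk cc hk hc
    rw [arrow_isNormalMonoN_iff hN] at hi
    rw [arrow_isNormalEpiN_iff hN] at hq
    obtain ⟨_, Z, g, hg⟩ := hi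
    obtain ⟨_, X, x, hx⟩ := hq
    rw [arrow_isKer_iff hN] at hk
    rw [arrow_isCoker_iff hN] at hc
    rw [arrowIdeal_null_comp_iff] at hnull
    obtain ⟨g', hg'⟩ := (hc.2.exists_desc_iff g).2 (by rw [← Arrow.w, Category.assoc]; exact hg.1)
    obtain ⟨x', hx'⟩ := (hk.2.subLe_iff x).2 (by
      rw [Arrow.w, ← Category.assoc]; exact hx.1)
    have hxg : N.null (x ≫ a.hom ≫ g) := by
      have := N.comp_right x' _ (N.comp_left _ g' hnull)
      rw [← hx', ← hg']
      simpa using this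
    obtain ⟨y, hy⟩ := (hg.subLe_iff x).2 hxg
    obtain ⟨w, hw⟩ := (hx.exists_desc_iff g).2 (by rwa [Category.assoc])
    refine ⟨Arrow.mk (i.left ≫ a.hom ≫ q.right), Arrow.homMk (𝟙 _) (i.right ≫ q.right) ?_,
      Arrow.homMk (i.left ≫ q.left) (𝟙 _) ?_, ?_, ?_, ?_⟩
    · simp
    · simp
    · rw [arrow_isNormalEpiN_iff hN]
      refine ⟨inferInstanceAs (IsIso (𝟙 _)), X, y, ?_⟩
      have := hx.epi
      have : Epi (i.right ≫ q.right) := epi_comp _ _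
      refine isCoker_of_epi (q := i.right ≫ q.right) fun Z g => ?_
      have h₁ : (y ≫ s.hom) ≫ g = (x ≫ a.hom) ≫ inv i.right ≫ g := by
        simp [← hy]
      rw [h₁, ← hx.exists_desc_iff]
      exact exists_congr fun u => by simp [IsIso.eq_inv_comp]
    · rw [arrow_isNormalMonoN_iff hN]
      refine ⟨inferInstanceAs (IsIso (𝟙 _)), Z, w, ?_⟩
      have := hg.mono
      have : Mono (i.left ≫ q.left) := mono_comp _ _
      refine isKer_of_mono (k := i.left ≫ q.left) fun Y t => ?_
      have hd : inv q.left ≫ a.hom ≫ q.right = d.hom := by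
        rw [IsIso.inv_comp_eq, Arrow.w]
      have h₁ : t ≫ d.hom ≫ w = (t ≫ inv q.left) ≫ a.hom ≫ g := by
        rw [← hw, Category.assoc, reassoc_of% hd]
      rw [h₁, ← hg.subLe_iff]
      exact exists_congr fun u => by simp [IsIso.eq_comp_inv]
    · ext <;> simp

lemma arrow_isNormalMonoN_left (hN : HasKerCoker N) {s a : Arrow C} {k : s ⟶ a}
    (hk : IsNormalMonoN (arrowIdeal N) k) : IsNormalMonoN N k.left :=
  let ⟨_, _, _, h⟩ := (arrow_isNormalMonoN_iff hN k).1 hk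
  ⟨_, _, h⟩

lemma arrow_subLe_iff (hN : HasKerCoker N) {s a x : Arrow C} {k : s ⟶ a}
    (hk : IsNormalMonoN (arrowIdeal N) k) (u : x ⟶ a) :
    SubLe u k ↔ SubLe u.left k.left := by
  obtain ⟨b, f, h⟩ := hk
  rw [h.subLe_iff, (((arrow_isKer_iff hN).1 h).2).subLe_iff, arrowIdeal_null_iff,
    Arrow.comp_left, Category.assoc]

lemma forall_arrow_null_imp_iff {s a x : Arrow C} (k : s ⟶ a) (u : x ⟶ a) :
    (∀ ⦃z : Arrow C⦄ (g : a ⟶ z), (arrowIdeal N).null (k ≫ g) → (arrowIdeal N).null (u ≫ g)) ↔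
      ∀ ⦃Z : C⦄ (g : a.right ⟶ Z), N.null (k.left ≫ a.hom ≫ g) →
        N.null (u.left ≫ a.hom ≫ g) := by
  simp only [arrowIdeal_null_comp_iff]
  exact forall_arrow_hom_right_iff
    (fun Z g => N.null (k.left ≫ a.hom ≫ g) → N.null (u.left ≫ a.hom ≫ g))

lemma arrow_subLe_joinN_iff (K : KernelChoice (arrowIdeal N)) {s t a x : Arrow C} (k : s ⟶ a)
    (l : t ⟶ a) (u : x ⟶ a) :
    SubLe u (joinN K k l) ↔ ∀ ⦃Z : C⦄ (g : a.right ⟶ Z), N.null (k.left ≫ a.hom ≫ g) →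
      N.null (l.left ≫ a.hom ≫ g) → N.null (u.left ≫ a.hom ≫ g) := by
  simp only [subLe_joinN_iff, arrowIdeal_null_comp_iff]
  exact forall_arrow_hom_right_iff (fun Z g => N.null (k.left ≫ a.hom ≫ g) →
      N.null (l.left ≫ a.hom ≫ g) → N.null (u.left ≫ a.hom ≫ g))

lemma arrow_modularityFor (hN : HasKerCoker N) (K : KernelChoice N) (hK : ModularityFor K)
    (K' : KernelChoice (arrowIdeal N)) : ModularityFor K' := by
  rw [modularityFor_iff] at hK ⊢
  obtain ⟨hmod, hleft, hright⟩ := hK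
  refine ⟨?_, ?_, ?_⟩
  · intro a b₁ b₂ c s₁ s₂ t h₁ h₂ ht hle x u hu hu'
    have n₁ := arrow_isNormalMonoN_left hN h₁
    have n₂ := arrow_isNormalMonoN_left hN h₂
    have nt := arrow_isNormalMonoN_left hN ht
    rw [arrow_subLe_iff hN h₂] at hle hu'
    rw [arrow_subLe_joinN_iff] at hu ⊢
    have hker : SubLe (K.ker a.hom) s₁.left := by
      obtain ⟨_, Z, g, hg⟩ := (arrow_isNormalMonoN_iff hN s₁).1 h₁
      rw [hg.subLe_iff, ← Category.assoc]
      exact N.comp_left _ _ (K.isKer _).1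
    rw [n₁.subLe_iff] at hker
    have hj : SubLe u.left (joinN K s₁.left t.left) := by
      have hu_join := hleft a.hom (joinN K s₁.left t.left) (isNormalMonoN_joinN K _ _) u.left
        fun Z g hg => hu g (null_comp_of_subLe (left_subLe_joinN K _ _) hg)
          (null_comp_of_subLe (right_subLe_joinN K _ _) hg)
      rw [subLe_joinN_iff] at hu_join ⊢
      exact fun Z g hs ht => hu_join g (null_joinN_comp K hs ht) (hker g hs)
    have hx := (subLe_joinN_iff K _ _ _).1
      (hmod s₁.left s₂.left t.left n₁ n₂ nt hle u.left hj hu')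
    refine fun Z g hg hg' => hx _ hg (null_comp_of_subLe ?_ hg')
    let m : Arrow.mk (meetN K t.left s₂.left ≫ a.hom) ⟶ a :=
      Arrow.homMk (meetN K t.left s₂.left) (𝟙 _)
    have hm : SubLe m (meetN K' t s₂) := by
      rw [subLe_meetN_iff K' ht h₂, arrow_subLe_iff hN ht, arrow_subLe_iff hN h₂]
      exact (subLe_meetN_iff K nt n₂ _).1 ⟨𝟙 _, Category.id_comp _⟩
    exact (arrow_subLe_iff hN (isNormalMonoN_meetN K' t s₂) m).1 hm
  · intro a b s f k hk x u hu
    have hu₁ : ∀ ⦃Z : C⦄ (g : b.right ⟶ Z), N.null (k.left ≫ (f.left ≫ b.hom) ≫ g) →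
        N.null (u.left ≫ (f.left ≫ b.hom) ≫ g) := by
      simp only [← Category.assoc _ f] at hu
      have := (forall_arrow_null_imp_iff (k ≫ f) (u ≫ f)).1 hu
      simpa only [Arrow.comp_left, Category.assoc] using this
    have hx := (subLe_joinN_iff K _ _ _).1
      (hleft (f.left ≫ b.hom) k.left (arrow_isNormalMonoN_left hN hk) u.left hu₁)
    rw [arrow_subLe_joinN_iff]
    refine fun Z g hg hg' => hx _ hg (null_comp_of_subLe ?_ hg')
    rw [((arrow_isKer_iff hN).1 (K'.isKer f)).2.subLe_iff]
    exact (K.isKer _).1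
  · intro a b t f l hl x u hu hu'
    rw [arrow_subLe_iff hN hl] at hu
    rw [subLe_imN_iff, forall_arrow_null_imp_iff] at hu'
    obtain ⟨_, Z, h, hh⟩ := (arrow_isNormalMonoN_iff hN l).1 hl
    have hx := hright (f.left ≫ b.hom) (K.ker h) ⟨_, _, K.isKer h⟩ (u.left ≫ b.hom)
      (by rwa [(K.isKer h).subLe_iff, Category.assoc, ← hh.subLe_iff])
      (by
        rw [subLe_imN_iff]
        simpa only [Category.assoc] using hu')
    rw [subLe_pushN_iff] at hx ⊢
    simp only [← Category.assoc _ f]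
    rw [forall_arrow_null_imp_iff]
    intro W g hg
    rw [← Category.assoc]
    refine hx g ?_
    rw [Arrow.comp_left, Category.assoc, ← Category.assoc f.left] at hg
    refine null_comp_of_subLe ?_ hg
    let m : Arrow.mk (pullN K (f.left ≫ b.hom) (K.ker h) ≫ a.hom) ⟶ a :=
      Arrow.homMk (pullN K (f.left ≫ b.hom) (K.ker h)) (𝟙 _)
    have hm : SubLe m (pullN K' f l) := by
      rw [subLe_pullN_iff_of_normal K' f hl, arrow_subLe_iff hN hl, Arrow.comp_left,
        hh.subLe_iff]
      have := (K.isKer h).subLe_iff _ |>.1 <|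
        (subLe_pullN_iff_of_normal K (f.left ≫ b.hom) ⟨_, _, K.isKer h⟩ m.left).1
          ⟨𝟙 _, Category.id_comp _⟩
      simpa only [Category.assoc] using this
    exact (arrow_subLe_iff hN (isNormalMonoN_pullN K' f l) m).1 hm

end ArrowCategory

/-- If `C` is a category with an ideal of null morphisms `N` with respect to which kernels
and cokernels exist, then the arrow category, with the ideal of squares with null diagonal,
is a homological category; and if `(C, N)` satisfies the modularity condition, then so does
the arrow category. -/
theorem stmt7 (N : NullIdeal C) (hN : HasKerCoker N) :
    IsHomologicalN (arrowIdeal N) ∧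
    ((∃ K : KernelChoice N, ModularityFor K) →
      ∃ K' : KernelChoice (arrowIdeal N), ModularityFor K') := by
  refine ⟨arrow_isHomologicalN hN, fun ⟨K, hK⟩ => ?_⟩
  obtain ⟨K'⟩ := exists_kernelChoice (arrow_hasKerCoker hN)
  exact ⟨K', arrow_modularityFor hN K hK K'⟩
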